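/- Let U be a finite set, ⟦np⟧, ⟦n⟧ ⊆ U fixed subsets, ⟦v⟧ ⊆ U × U a binary relation with forward image ⟦v⟧(A) = { y | ∃ x ∈ A, (x,y) ∈ ⟦v⟧ }, and ⟦d⟧ : 𝒫(U) → 𝒫(𝒫(U)) a function. Let V be the real vector space freely generated by 𝒫(U) with orthonormal basis { |A⟩ : A ⊆ U }. Define linear maps on basis vectors: δ|A⟩ = |A⟩ ⊗ |A⟩; μ(|A⟩ ⊗ |B⟩) = |A ∩ B⟩; d̄|A⟩ = Σ_{B ∈ ⟦d⟧(A)} |B⟩; ε(|A⟩ ⊗ |B⟩) = ⟨A|B⟩; n̄p(1) = |⟦np⟧⟩; n̄(1) = |⟦n⟧⟩; and v̄ : ℝ → V ⊗ V by v̄(1) = Σ_{A ⊆ U} |A⟩ ⊗ |⟦v⟧(A)⟩. Then ε ∘ (μ ⊗ d̄) ∘ (ε ⊗ id_V ⊗ δ) ∘ (n̄p ⊗ v̄ ⊗ n̄) applied to 1 equals Σ_{B ∈ ⟦d⟧(⟦n⟧)} ⟨⟦v⟧(⟦np⟧) ∩ ⟦n⟧ | B⟩, and this scalar is nonzero if and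 only if ⟦v⟧(⟦np⟧) ∩ ⟦n⟧ ∈ ⟦d⟧(⟦n⟧). -/

import Mathlib

open TensorProduct

noncomputable section

/-- The free real vector space over `𝒫(U)`. -/
abbrev FreeV (U : Type*) : Type _ := Set U →₀ ℝ

variable {U : Type*}

/-- The basis vector `|A⟩` of the free vector space over `𝒫(U)`. -/
def ket (A : Set U) : FreeV U := Finsupp.single A 1

/-- Forward image of a binary relation `v ⊆ U × U` on a set `A`. -/
def fwdImage (v : Set (U × U)) (A : Set U) : Set U := {y | ∃ x ∈ A, (x, y) ∈ v}

/-- The copying comultiplication `δ |A⟩ = |A⟩ ⊗ |A⟩`. -/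
def deltaMap (U : Type*) : FreeV U →ₗ[ℝ] FreeV U ⊗[ℝ] FreeV U :=
  Finsupp.lift _ ℝ (Set U) (fun A => ket A ⊗ₜ ket A)

/-- The intersection multiplication `μ (|A⟩ ⊗ |B⟩) = |A ∩ B⟩`. -/
def muMap (U : Type*) : FreeV U ⊗[ℝ] FreeV U →ₗ[ℝ] FreeV U :=
  TensorProduct.lift (Finsupp.lift _ ℝ (Set U)
    (fun A => Finsupp.lift (FreeV U) ℝ (Set U) (fun B => ket (A ∩ B))))

open Classical in
/-- The inner product `ε (|A⟩ ⊗ |B⟩) = ⟨A|B⟩`. -/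
def epsMap (U : Type*) : FreeV U ⊗[ℝ] FreeV U →ₗ[ℝ] ℝ :=
  TensorProduct.lift (Finsupp.lift _ ℝ (Set U)
    (fun A => Finsupp.lift ℝ ℝ (Set U) (fun B => if A = B then (1:ℝ) else 0)))

/-- The interpretation of the determiner: `d̄ |A⟩ = Σ_{B ∈ ⟦d⟧(A)} |B⟩`. -/
def dbarMap [Finite U] (d : Set U → Set (Set U)) : FreeV U →ₗ[ℝ] FreeV U :=
  Finsupp.lift _ ℝ (Set U) (fun A => ∑ B ∈ (Set.toFinite (d A)).toFinset, ket B)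

/-- The interpretation of a noun/noun phrase `x`: `x̄ (1) = |⟦x⟧⟩`. -/
def wordMap (A : Set U) : ℝ →ₗ[ℝ] FreeV U :=
  LinearMap.toSpanSingleton ℝ (FreeV U) (ket A)

/-- The interpretation of the verb: `v̄ (1) = Σ_{A ⊆ U} |A⟩ ⊗ |⟦v⟧(A)⟩`. -/
def vbarMap [Fintype U] (v : Set (U × U)) : ℝ →ₗ[ℝ] FreeV U ⊗[ℝ] FreeV U :=
  LinearMap.toSpanSingleton ℝ (FreeV U ⊗[ℝ] FreeV U)
    (∑ A : Set U, ket A ⊗ₜ ket (fwdImage v A))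

@[simp] lemma deltaMap_ket (A : Set U) : deltaMap U (ket A) = ket A ⊗ₜ ket A := by
  simp [deltaMap, ket]

@[simp] lemma muMap_ket_tmul_ket (A B : Set U) : muMap U (ket A ⊗ₜ ket B) = ket (A ∩ B) := by
  simp [muMap, ket]

open Classical in
@[simp] lemma epsMap_ket_tmul_ket (A B : Set U) :
    epsMap U (ket A ⊗ₜ ket B) = if A = B then (1 : ℝ) else 0 := by
  by_cases h : A = B <;> simp [epsMap, ket, h]

@[simp] lemma dbarMap_ket [Finite U] (d : Set U → Set (Set U)) (A : Set U) :
    dbarMap d (ket A) = ∑ B ∈ (Set.toFinite (d A)).toFinset, ket B := by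
  simp [dbarMap, ket]

@[simp] lemma wordMap_one (A : Set U) : wordMap A 1 = ket A := by
  simp [wordMap]

@[simp] lemma vbarMap_one [Fintype U] (v : Set (U × U)) :
    vbarMap v 1 = ∑ A : Set U, ket A ⊗ₜ ket (fwdImage v A) := by
  simp [vbarMap]

open Classical in
/-- The boolean `FdVect` semantics of a quantified sentence `NP V Det N`:
`ε ∘ (μ ⊗ d̄) ∘ (ε ⊗ id ⊗ δ) ∘ (n̄p ⊗ v̄ ⊗ n̄)` applied to `1` equals
`Σ_{B ∈ ⟦d⟧(⟦n⟧)} ⟨⟦v⟧(⟦np⟧) ∩ ⟦n⟧ | B⟩`, and it is nonzero iff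
`⟦v⟧(⟦np⟧) ∩ ⟦n⟧ ∈ ⟦d⟧(⟦n⟧)`. -/
theorem fdvect_semantics_np_v_det_n [Fintype U] (np n : Set U) (v : Set (U × U))
    (d : Set U → Set (Set U)) :
    (let F : ℝ →ₗ[ℝ] ℝ :=
      epsMap U
        ∘ₗ TensorProduct.map (muMap U) (dbarMap d)
        -- regrouping V ⊗ (V ⊗ V) ≅ (V ⊗ V) ⊗ V
        ∘ₗ (TensorProduct.assoc ℝ (FreeV U) (FreeV U) (FreeV U)).symm.toLinearMap
        -- unitor ℝ ⊗ (V ⊗ (V ⊗ V)) ≅ V ⊗ (V ⊗ V)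
        ∘ₗ (TensorProduct.lid ℝ (FreeV U ⊗[ℝ] (FreeV U ⊗[ℝ] FreeV U))).toLinearMap
        ∘ₗ TensorProduct.map (epsMap U) (TensorProduct.map LinearMap.id (deltaMap U))
        -- regrouping V ⊗ (V ⊗ (V ⊗ V)) ≅ (V ⊗ V) ⊗ (V ⊗ V)
        ∘ₗ (TensorProduct.assoc ℝ (FreeV U) (FreeV U) (FreeV U ⊗[ℝ] FreeV U)).symm.toLinearMap
        -- regrouping V ⊗ ((V ⊗ V) ⊗ V) ≅ V ⊗ (V ⊗ (V ⊗ V))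
        ∘ₗ (TensorProduct.congr (LinearEquiv.refl ℝ (FreeV U))
              (TensorProduct.assoc ℝ (FreeV U) (FreeV U) (FreeV U))).toLinearMap
        ∘ₗ TensorProduct.map (wordMap np) (TensorProduct.map (vbarMap v) (wordMap n))
        -- unitors ℝ ≅ ℝ ⊗ (ℝ ⊗ ℝ)
        ∘ₗ (TensorProduct.congr (LinearEquiv.refl ℝ ℝ)
              (TensorProduct.lid ℝ ℝ).symm).toLinearMap
        ∘ₗ (TensorProduct.lid ℝ ℝ).symm.toLinearMap
     (F 1 = ∑ B ∈ (Set.toFinite (d n)).toFinset,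
        (if fwdImage v np ∩ n = B then (1:ℝ) else 0)) ∧
     (F 1 ≠ 0 ↔ fwdImage v np ∩ n ∈ d n)) := by
  intro F
  have h : F 1 = ∑ B ∈ (Set.toFinite (d n)).toFinset,
      (if fwdImage v np ∩ n = B then (1 : ℝ) else 0) := by
    simp [F, TensorProduct.sum_tmul, TensorProduct.tmul_sum, ite_smul, apply_ite,
      -Finset.sum_boole]
  refine ⟨h, ?_⟩
  rw [h]
  simp

end
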